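/- Let λ > 1 and let K_i ⊂ ℝ³ be convex bodies containing the origin in their closures, each solving the logarithmic Minkowski problem with density f_i, where 1/λ < f_i < λ and f_i → 1 uniformly on S². Suppose the support functions satisfy ‖h_{K_i}‖_{L∞(S²)} ≤ C for all i. Then there is a subsequence of K_i converging in Hausdorff distance to a convex body K_∞ containing the origin in its closure, and K_∞ solves the logarithmic Minkowski problem with constant density 1, i.e. h_{K_∞} dS_{K_∞} = dH² (equivalently 3 V_{K_∞}(ω) = H²(ω) for every Borel ω ⊂ S²). -/

import Mathlib

open MeasureTheory Metric Set Filter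
open scoped RealInnerProductSpace ENNReal NNReal Real

noncomputable section

abbrev E3 := EuclideanSpace ℝ (Fin 3)

def unitSphere : Set E3 := Metric.sphere 0 1

def IsConvexBody (K : Set E3) : Prop :=
  Convex ℝ K ∧ IsCompact K ∧ (interior K).Nonempty

def suppFn (K : Set E3) (x : E3) : ℝ := sSup ((fun y => ⟪x, y⟫) '' K)

def outerNormalAt (K : Set E3) (x ν : E3) : Prop :=
  ‖ν‖ = 1 ∧ ∀ z ∈ K, ⟪ν, z - x⟫ ≤ (0:ℝ)

def gaussPre (K : Set E3) (ω : Set E3) : Set E3 :=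
  {x ∈ frontier K | ∃ ν ∈ ω, outerNormalAt K x ν}

def coneOver (G : Set E3) : Set E3 := {y | ∃ x ∈ G, ∃ t ∈ Set.Icc (0:ℝ) 1, y = t • x}

def SolvesLMP (K : Set E3) (f : E3 → ℝ) : Prop :=
  ∀ ω : Set E3, ω ⊆ unitSphere → MeasurableSet ω →
    3 * (volume (coneOver (gaussPre K ω))).toReal = ∫ u in ω, f u ∂(μH[2])

def sphSupNorm (f : E3 → ℝ) : ℝ := sSup {c | ∃ x ∈ unitSphere, c = |f x|}

def sphHolderSemi (α : ℝ) (f : E3 → ℝ) : ℝ :=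
  sSup {c | ∃ x ∈ unitSphere, ∃ y ∈ unitSphere, x ≠ y ∧ c = |f x - f y| / ‖x - y‖ ^ α}

def sphHolderNorm (α : ℝ) (f : E3 → ℝ) : ℝ := sphSupNorm f + sphHolderSemi α f

open scoped Topology

/-- `ν` is a normal of `K` at the point where the ray through `y` leaves `K`. -/
def RayNormal (K : Set E3) (y ν : E3) : Prop :=
  ∃ s : ℝ, 1 ≤ s ∧ s • y ∈ K ∧ outerNormalAt K (s • y) ν

def bodyGauge (K : Set E3) (y : E3) : ℝ := sInf {r : ℝ | 0 < r ∧ ∃ k ∈ K, y = r • k}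

lemma bodyGauge_bdd (K : Set E3) (y : E3) : BddBelow {r : ℝ | 0 < r ∧ ∃ k ∈ K, y = r • k} :=
  ⟨0, fun _ h => h.1.le⟩

lemma bodyGauge_convexOn {K : Set E3} (hK : Convex ℝ K) : ConvexOn ℝ K (bodyGauge K) := by
  refine ⟨hK, ?_⟩
  intro x hx y hy a b ha hb hab
  have key : ∀ r1 ∈ {r : ℝ | 0 < r ∧ ∃ k ∈ K, x = r • k}, ∀ r2 ∈ {r : ℝ | 0 < r ∧ ∃ k ∈ K, y = r • k},
      bodyGauge K (a • x + b • y) ≤ a * r1 + b * r2 := by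
    rintro r1 ⟨h1, k1, hk1, rfl⟩ r2 ⟨h2, k2, hk2, rfl⟩
    have hpos : 0 < a * r1 + b * r2 := by
      rcases ha.eq_or_lt with h | h
      · have : b = 1 := by linarith
        subst this; subst h; simpa using h2
      · have := mul_pos h h1
        have := mul_nonneg hb h2.le
        linarith
    refine csInf_le (bodyGauge_bdd _ _) ⟨hpos, ((a * r1) / (a * r1 + b * r2)) • k1 + ((b * r2) / (a * r1 + b * r2)) • k2,
      hK hk1 hk2 (by positivity) (by positivity) (by field_simp), ?_⟩
    rw [smul_add, smul_smul, smul_smul, smul_smul, smul_smul, mul_div_cancel₀ _ hpos.ne', mul_div_cancel₀ _ hpos.ne']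
  have hx' : (1:ℝ) ∈ {r : ℝ | 0 < r ∧ ∃ k ∈ K, x = r • k} := ⟨one_pos, x, hx, by simp⟩
  have hy' : (1:ℝ) ∈ {r : ℝ | 0 < r ∧ ∃ k ∈ K, y = r • k} := ⟨one_pos, y, hy, by simp⟩
  refine le_of_forall_pos_le_add fun ε hε => ?_
  obtain ⟨r1, h1, h1'⟩ := Real.lt_sInf_add_pos ⟨1, hx'⟩ hε
  obtain ⟨r2, h2, h2'⟩ := Real.lt_sInf_add_pos ⟨1, hy'⟩ hε
  refine (key r1 h1 r2 h2).trans ?_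
  change r1 < bodyGauge K x + ε at h1'
  change r2 < bodyGauge K y + ε at h2'
  have e1 := mul_le_mul_of_nonneg_left h1'.le ha
  have e2 := mul_le_mul_of_nonneg_left h2'.le hb
  simp only [smul_eq_mul]
  have : ε = a * ε + b * ε := by rw [← add_mul, hab, one_mul]
  linarith

lemma bodyGauge_ae_diff {K : Set E3} (hK : Convex ℝ K) :
    ∀ᵐ y ∂(volume : Measure E3), y ∈ interior K → DifferentiableAt ℝ (bodyGauge K) y := by
  have hl := (bodyGauge_convexOn hK).locallyLipschitzOn_interior
  rw [ae_iff]
  refine measure_null_of_locally_null _ fun x hx => ?_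
  simp only [mem_ofPred_eq, Classical.not_imp] at hx
  obtain ⟨c, t, ht, hlip⟩ := hl hx.1
  rw [isOpen_interior.nhdsWithin_eq hx.1] at ht
  obtain ⟨u, hut, huo, hxu⟩ := _root_.mem_nhds_iff.1 ht
  have := (hlip.mono hut).ae_differentiableWithinAt_of_mem (μ := (volume : Measure E3))
  rw [ae_iff] at this
  refine ⟨u ∩ {a | ¬(a ∈ interior K → DifferentiableAt ℝ (bodyGauge K) a)}, ?_, measure_mono_null ?_ this⟩
  · rw [inter_comm]
    exact inter_mem_nhdsWithin _ (huo.mem_nhds hxu)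
  · rintro y ⟨hyu, hy⟩ hd
    exact hy fun _ => (hd hyu).differentiableAt (huo.mem_nhds hyu)

lemma RayNormal.inner_pos {K : Set E3} (h0 : (0 : E3) ∈ K) {y ν : E3} (hy : y ∈ interior K)
    (h : RayNormal K y ν) : 0 < (⟪ν, y⟫ : ℝ) := by
  obtain ⟨s, hs, hsK, hν, hn⟩ := h
  have h1 := hn 0 h0
  rw [zero_sub, inner_neg_right, real_inner_smul_right] at h1
  have h2 : 0 ≤ (⟪ν, y⟫ : ℝ) := by
    by_contra hc
    have : s * (⟪ν, y⟫ : ℝ) < 0 := mul_neg_of_pos_of_neg (by linarith) (not_le.1 hc)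
    linarith
  refine lt_of_le_of_ne h2 fun h3 => ?_
  obtain ⟨ε, hε, hb⟩ := Metric.isOpen_iff.1 isOpen_interior y hy
  have hm : y + (ε/2) • ν ∈ K := interior_subset (hb (by
    rw [mem_ball, dist_eq_norm, add_sub_cancel_left, norm_smul, hν]
    rw [Real.norm_of_nonneg (by positivity)]; linarith))
  have h4 := hn _ hm
  rw [inner_sub_right, inner_add_right, real_inner_smul_right, real_inner_smul_right, ← h3,
    real_inner_self_eq_norm_sq, hν] at h4
  linarith

lemma RayNormal.fderiv_eq {K : Set E3} (h0 : (0 : E3) ∈ K) {y ν : E3} (hy : y ∈ interior K)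
    (h : RayNormal K y ν) (hd : DifferentiableAt ℝ (bodyGauge K) y) :
    0 < bodyGauge K y ∧
    ν = (⟪ν, y⟫ / bodyGauge K y) • (InnerProductSpace.toDual ℝ E3).symm (fderiv ℝ (bodyGauge K) y) := by
  have hp := h.inner_pos h0 hy
  obtain ⟨s, hs, hsK, hν, hn⟩ := h
  have hs0 : 0 < s := by linarith
  have sub : ∀ y' ∈ K, (⟪ν, y'⟫ : ℝ) ≤ bodyGauge K y' * (s * ⟪ν, y⟫) := by
    intro y' hy'
    rw [← div_le_iff₀ (by positivity)]
    refine le_csInf ⟨1, one_pos, y', hy', by simp⟩ ?_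
    rintro r ⟨hr, k, hk, rfl⟩
    have := hn k hk
    rw [inner_sub_right, real_inner_smul_right] at this
    rw [div_le_iff₀ (by positivity), real_inner_smul_right]
    exact mul_le_mul_of_nonneg_left (by linarith) hr.le
  have hle : bodyGauge K y ≤ s⁻¹ := csInf_le (bodyGauge_bdd _ _)
    ⟨by positivity, s • y, hsK, by rw [smul_smul, inv_mul_cancel₀ hs0.ne', one_smul]⟩
  have hge := sub y (interior_subset hy)
  have hg : bodyGauge K y = s⁻¹ := by
    refine le_antisymm hle ?_
    rw [inv_le_iff_one_le_mul₀ hs0]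
    by_contra hc
    push Not at hc
    have := mul_lt_mul_of_pos_right hc hp
    linarith
  refine ⟨by rw [hg]; positivity, ?_⟩
  have hmin : IsLocalMin (fun z => bodyGauge K z * (s * ⟪ν, y⟫) - (innerSL ℝ ν) z) y := by
    filter_upwards [isOpen_interior.mem_nhds hy] with z hz
    have := sub z (interior_subset hz)
    simp only [innerSL_apply_apply]
    rw [hg, inv_mul_cancel_left₀ hs0.ne', sub_self]
    linarith
  have hder := (hd.hasFDerivAt.mul_const (s * ⟪ν, y⟫)).sub (innerSL ℝ ν).hasFDerivAt
  have hz := hmin.hasFDerivAt_eq_zero hder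
  apply ext_inner_right ℝ
  intro v
  have := congrArg (fun L : E3 →L[ℝ] ℝ => L v) hz
  simp at this
  rw [real_inner_smul_left, InnerProductSpace.toDual_symm_apply, hg]
  rw [div_inv_eq_mul]
  linarith

lemma rayNormal_unique {K : Set E3} (hK : Convex ℝ K) (h0 : (0 : E3) ∈ K) :
    ∀ᵐ y ∂(volume : Measure E3), y ∈ interior K →
      ∀ ν₁ ν₂, RayNormal K y ν₁ → RayNormal K y ν₂ → ν₁ = ν₂ := by
  filter_upwards [bodyGauge_ae_diff hK] with y hy hyK ν₁ ν₂ h1 h2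
  obtain ⟨hg, e1⟩ := h1.fderiv_eq h0 hyK (hy hyK)
  obtain ⟨-, e2⟩ := h2.fderiv_eq h0 hyK (hy hyK)
  have p1 := h1.inner_pos h0 hyK
  have p2 := h2.inner_pos h0 hyK
  set w := (InnerProductSpace.toDual ℝ E3).symm (fderiv ℝ (bodyGauge K) y)
  have n1 : ‖ν₁‖ = 1 := by obtain ⟨s, _, _, h, _⟩ := h1; exact h
  have n2 : ‖ν₂‖ = 1 := by obtain ⟨s, _, _, h, _⟩ := h2; exact h
  have a1 : 0 < ⟪ν₁, y⟫ / bodyGauge K y := by positivity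
  have a2 : 0 < ⟪ν₂, y⟫ / bodyGauge K y := by positivity
  generalize ⟪ν₁, y⟫ / bodyGauge K y = c1 at *
  generalize ⟪ν₂, y⟫ / bodyGauge K y = c2 at *
  subst e1; subst e2
  rw [norm_smul, Real.norm_of_nonneg a1.le] at n1
  rw [norm_smul, Real.norm_of_nonneg a2.le] at n2
  have hw : ‖w‖ ≠ 0 := by intro h; rw [h] at n1; simp at n1
  have : c1 = c2 := mul_right_cancel₀ hw (n1.trans n2.symm)
  rw [this]

lemma exists_normal {K : Set E3} (hK : Convex ℝ K) (hi : (interior K).Nonempty) {x : E3}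
    (hx : x ∉ interior K) : ∃ ν, outerNormalAt K x ν := by
  obtain ⟨L, hL⟩ := geometric_hahn_banach_open_point hK.interior isOpen_interior hx
  set v := (InnerProductSpace.toDual ℝ E3).symm L
  have hv : ∀ z, ⟪v, z⟫ = L z := fun z => InnerProductSpace.toDual_symm_apply
  have hv0 : v ≠ 0 := by
    intro h
    obtain ⟨a, ha⟩ := hi
    have := hL a ha
    rw [← hv, ← hv, h] at this
    simp at this
  have hcl : ∀ z ∈ K, L z ≤ L x := by
    intro z hz
    have hz' : z ∈ closure (interior K) := by
      rw [hK.closure_interior_eq_closure_of_nonempty_interior hi]; exact subset_closure hz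
    exact closure_minimal (fun a ha => (hL a ha).le) (isClosed_le L.continuous continuous_const) hz'
  refine ⟨‖v‖⁻¹ • v, ?_, fun z hz => ?_⟩
  · rw [norm_smul, norm_inv, norm_norm, inv_mul_cancel₀ (norm_ne_zero_iff.2 hv0)]
  · rw [real_inner_smul_left, hv, map_sub]
    exact mul_nonpos_of_nonneg_of_nonpos (by positivity) (by linarith [hcl z hz])

lemma exists_rayNormal {K : Set E3} (hK : IsConvexBody K) {y : E3} (hy : y ∈ K)
    (hy0 : y ≠ 0) : ∃ ν, RayNormal K y ν := by
  obtain ⟨hc, hk, hi⟩ := hK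
  obtain ⟨R, hR⟩ := hk.isBounded.exists_norm_le
  have hny : 0 < ‖y‖ := norm_pos_iff.2 hy0
  set T := {s : ℝ | 1 ≤ s ∧ s • y ∈ K}
  have hT1 : (1:ℝ) ∈ T := ⟨le_rfl, by simpa using hy⟩
  have hTc : IsCompact T := by
    refine (isCompact_Icc (a := (1:ℝ)) (b := R / ‖y‖)).of_isClosed_subset ?_ ?_
    · exact isClosed_Ici.inter (hk.isClosed.preimage (by fun_prop))
    · rintro s ⟨h1, h2⟩
      refine ⟨h1, ?_⟩
      have := hR _ h2
      rw [norm_smul, Real.norm_of_nonneg (by linarith)] at this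
      rwa [le_div_iff₀ hny]
  obtain ⟨s, ⟨hs, hsK⟩, hmax⟩ := hTc.exists_isMaxOn ⟨1, hT1⟩ continuousOn_id
  have hns : s • y ∉ interior K := by
    intro h
    have hnhds : ∀ᶠ r in 𝓝 s, r • y ∈ interior K :=
      (show ContinuousAt (fun r : ℝ => r • y) s by fun_prop).eventually (isOpen_interior.mem_nhds h)
    have hnh2 : ∀ᶠ r in 𝓝[>] s, r • y ∈ interior K := hnhds.filter_mono nhdsWithin_le_nhds
    obtain ⟨r, hr, hr2⟩ := (hnh2.and self_mem_nhdsWithin).exists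
    have hr2 : s < r := hr2
    have := hmax (show r ∈ T from ⟨by linarith, interior_subset hr⟩)
    simp at this
    linarith
  obtain ⟨ν, hν⟩ := exists_normal hc hi hns
  exact ⟨ν, s, hs, hsK, hν⟩

lemma outerNormal_frontier {K : Set E3} {x ν : E3} (hx : x ∈ K) (h : outerNormalAt K x ν) :
    x ∈ frontier K := by
  refine ⟨subset_closure hx, fun hi => ?_⟩
  obtain ⟨ε, hε, hb⟩ := Metric.isOpen_iff.1 isOpen_interior x hi
  have hm : x + (ε/2) • ν ∈ K := interior_subset (hb (by
    rw [mem_ball, dist_eq_norm, add_sub_cancel_left, norm_smul, h.1]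
    rw [Real.norm_of_nonneg (by positivity)]; linarith))
  have h4 := h.2 _ hm
  rw [add_sub_cancel_left, real_inner_smul_right, real_inner_self_eq_norm_sq, h.1] at h4
  linarith

lemma mem_coneOver_iff {K : Set E3} (hK : IsCompact K) {y : E3} (hy0 : y ≠ 0) (ω : Set E3) :
    y ∈ coneOver (gaussPre K ω) ↔ ∃ ν ∈ ω, RayNormal K y ν := by
  constructor
  · rintro ⟨x, ⟨hx, ν, hν, hn⟩, t, ht, rfl⟩
    have ht0 : t ≠ 0 := by rintro rfl; simp at hy0
    have htp : 0 < t := lt_of_le_of_ne ht.1 (Ne.symm ht0)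
    have e : t⁻¹ • t • x = x := by rw [smul_smul, inv_mul_cancel₀ ht0, one_smul]
    refine ⟨ν, hν, t⁻¹, (one_le_inv₀ htp).2 ht.2, ?_, ?_⟩
    · rw [e]; exact hK.isClosed.frontier_subset hx
    · rw [e]; exact hn
  · rintro ⟨ν, hν, s, hs, hsK, hn⟩
    have hs0 : 0 < s := by linarith
    exact ⟨s • y, ⟨outerNormal_frontier hsK hn, ν, hν, hn⟩, s⁻¹,
      ⟨by positivity, inv_le_one_of_one_le₀ hs⟩, by rw [smul_smul, inv_mul_cancel₀ hs0.ne', one_smul]⟩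

lemma coneOver_subset {K : Set E3} (hK : IsConvexBody K) (h0 : (0 : E3) ∈ K) (ω : Set E3) :
    coneOver (gaussPre K ω) ⊆ K := by
  rintro y ⟨x, ⟨hx, -⟩, t, ht, rfl⟩
  exact hK.1.smul_mem_of_zero_mem h0 (hK.2.1.isClosed.frontier_subset hx) ht

lemma isClosed_coneOver {K : Set E3} (hK : IsCompact K) {F : Set E3} (hF : IsCompact F) :
    IsClosed (coneOver (gaussPre K F)) := by
  have h1 : IsCompact {p : E3 × E3 | p ∈ K ×ˢ F ∧ p.1 ∈ frontier K ∧ outerNormalAt K p.1 p.2} := by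
    refine (hK.prod hF).of_isClosed_subset ?_ fun p hp => hp.1
    have e : {p : E3 × E3 | p ∈ K ×ˢ F ∧ p.1 ∈ frontier K ∧ outerNormalAt K p.1 p.2} =
      (K ×ˢ F) ∩ ((Prod.fst ⁻¹' frontier K) ∩ ({p | ‖p.2‖ = 1} ∩ ⋂ z ∈ K, {p | (⟪p.2, z - p.1⟫ : ℝ) ≤ 0})) := by
      ext p; simp [outerNormalAt]
    rw [e]
    refine ((hK.prod hF).isClosed).inter ((isClosed_frontier.preimage continuous_fst).inter
      ((isClosed_eq (by fun_prop) continuous_const).inter (isClosed_biInter fun z hz =>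
        isClosed_le (by fun_prop) continuous_const)))
  have h2 : coneOver (gaussPre K F) = (fun q : ℝ × (E3 × E3) => q.1 • q.2.1) ''
      (Icc (0:ℝ) 1 ×ˢ {p : E3 × E3 | p ∈ K ×ˢ F ∧ p.1 ∈ frontier K ∧ outerNormalAt K p.1 p.2}) := by
    ext y
    constructor
    · rintro ⟨x, ⟨hx, ν, hν, hn⟩, t, ht, rfl⟩
      exact ⟨(t, (x, ν)), ⟨ht, ⟨hK.isClosed.frontier_subset hx, hν⟩, hx, hn⟩, rfl⟩
    · rintro ⟨⟨t, x, ν⟩, ⟨ht, ⟨hx, hν⟩, hfr, hn⟩, rfl⟩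
      exact ⟨x, ⟨hfr, ν, hν, hn⟩, t, ht, rfl⟩
  rw [h2]
  exact ((isCompact_Icc.prod h1).image (by fun_prop)).isClosed

open Classical in
def rayNrm (K : Set E3) (y : E3) : E3 := if h : ∃ ν, RayNormal K y ν then h.choose else 0

lemma rayNrm_spec {K : Set E3} {y : E3} (h : ∃ ν, RayNormal K y ν) : RayNormal K y (rayNrm K y) := by
  unfold rayNrm
  rw [dif_pos h]
  exact h.choose_spec

lemma RayNormal.norm_eq {K : Set E3} {y ν : E3} (h : RayNormal K y ν) : ‖ν‖ = 1 := by
  obtain ⟨s, _, _, h, _⟩ := h; exact h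

lemma ae_good {K : Set E3} (hK : IsConvexBody K) (h0 : (0 : E3) ∈ K) :
    ∀ᵐ y ∂(volume : Measure E3), y ∈ K → y ∈ interior K ∧ y ≠ 0 ∧ RayNormal K y (rayNrm K y) ∧
      ∀ ν, RayNormal K y ν → ν = rayNrm K y := by
  have h1 : ∀ᵐ y ∂(volume : Measure E3), y ∉ frontier K :=
    measure_eq_zero_iff_ae_notMem.1 (hK.1.addHaar_frontier _)
  have h2 : ∀ᵐ y ∂(volume : Measure E3), y ∉ ({0} : Set E3) :=
    measure_eq_zero_iff_ae_notMem.1 (measure_singleton _)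
  filter_upwards [h1, h2, rayNormal_unique hK.1 h0] with y hy1 hy2 hy3 hyK
  have hyi : y ∈ interior K := by
    by_contra hc
    exact hy1 ⟨subset_closure hyK, hc⟩
  have hy0 : y ≠ 0 := hy2
  have hs := rayNrm_spec (exists_rayNormal hK hyK hy0)
  exact ⟨hyi, hy0, hs, fun ν hν => hy3 hyi _ _ hν hs⟩

lemma ae_good' {K : Set E3} (hK : IsConvexBody K) (h0 : (0 : E3) ∈ K) :
    ∀ᵐ y ∂((volume : Measure E3).restrict K), y ∈ interior K ∧ y ≠ 0 ∧ RayNormal K y (rayNrm K y) ∧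
      ∀ ν, RayNormal K y ν → ν = rayNrm K y :=
  (ae_restrict_iff' hK.2.1.isClosed.measurableSet).2 (ae_good hK h0)

lemma cone_ae {K : Set E3} (hK : IsConvexBody K) (h0 : (0 : E3) ∈ K) (ω : Set E3) :
    coneOver (gaussPre K ω) =ᵐ[(volume : Measure E3).restrict K] rayNrm K ⁻¹' ω := by
  filter_upwards [ae_good' hK h0] with y hy
  obtain ⟨-, hy0, hs, hu⟩ := hy
  refine propext ?_
  refine (mem_coneOver_iff hK.2.1 hy0 ω).trans ⟨?_, fun h => ⟨_, h, hs⟩⟩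
  rintro ⟨ν, hν, hr⟩
  rw [hu ν hr] at hν
  exact hν

lemma rayNrm_sphere_ae {K : Set E3} (hK : IsConvexBody K) (h0 : (0 : E3) ∈ K) :
    ∀ᵐ y ∂((volume : Measure E3).restrict K), rayNrm K y ∈ unitSphere := by
  filter_upwards [ae_good' hK h0] with y hy
  simpa [unitSphere] using hy.2.2.1.norm_eq

lemma rayNrm_aemeasurable {K : Set E3} (hK : IsConvexBody K) (h0 : (0 : E3) ∈ K) :
    AEMeasurable (rayNrm K) ((volume : Measure E3).restrict K) := by
  have hn : NullMeasurable (rayNrm K) ((volume : Measure E3).restrict K) := by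
    refine @measurable_of_isClosed _ (NullMeasurableSpace E3 ((volume : Measure E3).restrict K)) _ _ _ _ _ fun F hF => ?_
    have h1 : NullMeasurableSet (coneOver (gaussPre K (F ∩ unitSphere))) ((volume : Measure E3).restrict K) :=
      (isClosed_coneOver hK.2.1 ((isCompact_sphere (0:E3) 1).inter_left hF)).measurableSet.nullMeasurableSet
    have h2 : NullMeasurableSet (rayNrm K ⁻¹' F) ((volume : Measure E3).restrict K) := by
      refine h1.congr ((cone_ae hK h0 _).trans ?_)
      filter_upwards [rayNrm_sphere_ae hK h0] with y hy
      exact propext ⟨fun h => h.1, fun h => ⟨h, hy⟩⟩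
    exact h2
  exact hn.aemeasurable_of_aerange (t := univ) (by simp)

lemma vol_cone {K : Set E3} (hK : IsConvexBody K) (h0 : (0 : E3) ∈ K) {ω : Set E3}
    (hω : MeasurableSet ω) :
    volume (coneOver (gaussPre K ω)) = (((volume : Measure E3).restrict K).map (rayNrm K)) ω := by
  rw [Measure.map_apply_of_aemeasurable (rayNrm_aemeasurable hK h0) hω, ← measure_congr (cone_ae hK h0 ω),
    Measure.restrict_apply' hK.2.1.isClosed.measurableSet, inter_eq_left.2 (coneOver_subset hK h0 ω)]

lemma map_sphere {K : Set E3} (hK : IsConvexBody K) (h0 : (0 : E3) ∈ K) {ω : Set E3}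
    (hω : MeasurableSet ω) :
    (((volume : Measure E3).restrict K).map (rayNrm K)) ω
      = (((volume : Measure E3).restrict K).map (rayNrm K)) (ω ∩ unitSphere) := by
  have hS : MeasurableSet unitSphere := isClosed_sphere.measurableSet
  rw [Measure.map_apply_of_aemeasurable (rayNrm_aemeasurable hK h0) hω,
    Measure.map_apply_of_aemeasurable (rayNrm_aemeasurable hK h0) (hω.inter hS)]
  refine measure_congr ?_
  filter_upwards [rayNrm_sphere_ae hK h0] with y hy
  exact propext ⟨fun h => ⟨h, hy⟩, fun h => h.1⟩

lemma vol_cone_sphere {K : Set E3} (hK : IsConvexBody K) (h0 : (0 : E3) ∈ K) :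
    volume (coneOver (gaussPre K unitSphere)) = volume K := by
  have hS : MeasurableSet unitSphere := isClosed_sphere.measurableSet
  have := map_sphere hK h0 MeasurableSet.univ
  rw [univ_inter, ← vol_cone hK h0 hS] at this
  rw [← this, Measure.map_apply_of_aemeasurable (rayNrm_aemeasurable hK h0) MeasurableSet.univ]
  simp

lemma volume_pos {K : Set E3} (hK : IsConvexBody K) : 0 < (volume K).toReal :=
  ENNReal.toReal_pos ((isOpen_interior.measure_pos _ hK.2.2).trans_le (measure_mono interior_subset)).ne'
    hK.2.1.measure_lt_top.ne

lemma lmp_integrable {K : Set E3} (hK : IsConvexBody K) (h0 : (0 : E3) ∈ K) {f : E3 → ℝ}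
    (hs : SolvesLMP K f) : IntegrableOn f unitSphere μH[2] := by
  have hS : MeasurableSet unitSphere := isClosed_sphere.measurableSet
  have h := hs unitSphere subset_rfl hS
  rw [vol_cone_sphere hK h0] at h
  by_contra hc
  rw [integral_undef hc] at h
  have := volume_pos hK
  linarith

lemma lmp_integral {K : Set E3} (hK : IsConvexBody K) (h0 : (0 : E3) ∈ K) {f : E3 → ℝ}
    (hf : ∀ u ∈ unitSphere, 0 ≤ f u)
    (hs : SolvesLMP K f) (φ : BoundedContinuousFunction E3 ℝ) :
    ∫ y in K, φ (rayNrm K y) = ∫ u in unitSphere, f u / 3 * φ u ∂μH[2] := by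
  have hS : MeasurableSet unitSphere := isClosed_sphere.measurableSet
  have hi := lmp_integrable hK h0 hs
  have hi3 : Integrable (fun u => f u / 3) ((μH[2] : Measure E3).restrict unitSphere) := hi.div_const 3
  have hm : (((volume : Measure E3).restrict K).map (rayNrm K)) =
      ((μH[2] : Measure E3).restrict unitSphere).withDensity (fun u => ENNReal.ofReal (f u / 3)) := by
    ext ω hω
    have hωS := hω.inter hS
    have hfin : volume (coneOver (gaussPre K (ω ∩ unitSphere))) ≠ ⊤ :=
      ((measure_mono (coneOver_subset hK h0 _)).trans_lt hK.2.1.measure_lt_top).ne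
    have h := hs (ω ∩ unitSphere) inter_subset_right hωS
    rw [map_sphere hK h0 hω, ← vol_cone hK h0 hωS, withDensity_apply _ hω, Measure.restrict_restrict hω,
      ← ofReal_integral_eq_lintegral_ofReal, integral_div, ← h, mul_div_cancel_left₀ _ (by norm_num),
      ENNReal.ofReal_toReal hfin]
    · exact hi3.mono_measure (Measure.restrict_mono inter_subset_right le_rfl)
    · filter_upwards [ae_restrict_mem hωS] with u hu
      have := hf u hu.2
      simp only [Pi.zero_apply]; positivity
  rw [← integral_map (rayNrm_aemeasurable hK h0) φ.continuous.aestronglyMeasurable, hm,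
    integral_withDensity_eq_integral_toReal_smul₀ hi3.aestronglyMeasurable.aemeasurable.ennreal_ofReal (by simp)]
  refine setIntegral_congr_fun hS fun u hu => ?_
  have := hf u hu
  simp only [smul_eq_mul]
  rw [ENNReal.toReal_ofReal (by positivity)]

lemma lmp_of_integral {K : Set E3} (hK : IsConvexBody K) (h0 : (0 : E3) ∈ K)
    (hfin : (μH[2] : Measure E3) unitSphere ≠ ⊤)
    (h : ∀ φ : BoundedContinuousFunction E3 ℝ,
      ∫ y in K, φ (rayNrm K y) = ∫ u in unitSphere, 1 / 3 * φ u ∂μH[2]) :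
    SolvesLMP K (fun _ => 1) := by
  have hS : MeasurableSet unitSphere := isClosed_sphere.measurableSet
  haveI : IsFiniteMeasure ((μH[2] : Measure E3).restrict unitSphere) :=
    ⟨by rw [Measure.restrict_apply_univ]; exact hfin.lt_top⟩
  haveI : IsFiniteMeasure ((volume : Measure E3).restrict K) :=
    ⟨by rw [Measure.restrict_apply_univ]; exact hK.2.1.measure_lt_top⟩
  have hm : (((volume : Measure E3).restrict K).map (rayNrm K)) =
      (ENNReal.ofReal (1/3)) • ((μH[2] : Measure E3).restrict unitSphere) := by
    haveI := Measure.smul_finite ((μH[2] : Measure E3).restrict unitSphere) (ENNReal.ofReal_ne_top (r := 1/3))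
    refine ext_of_forall_integral_eq_of_IsFiniteMeasure fun φ => ?_
    rw [integral_map (rayNrm_aemeasurable hK h0) φ.continuous.aestronglyMeasurable, h φ, integral_smul_measure,
      integral_const_mul, ENNReal.toReal_ofReal (by norm_num), smul_eq_mul]
  intro ω hω hωm
  rw [vol_cone hK h0 hωm, hm, Measure.smul_apply, Measure.restrict_apply hωm, inter_eq_left.2 hω,
    smul_eq_mul, ENNReal.toReal_mul, ENNReal.toReal_ofReal (by norm_num)]
  simp [Measure.real]

section Conv
variable {A : ℕ → Set E3} {B : Set E3}

lemma haus_ne_top (hA : ∀ i, IsCompact (A i)) (hA0 : ∀ i, (0:E3) ∈ A i) (hB : IsCompact B) (hB0 : (0:E3) ∈ B) (i : ℕ) :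
    hausdorffEDist (A i) B ≠ ⊤ :=
  hausdorffEDist_ne_top_of_nonempty_of_bounded ⟨0, hA0 i⟩ ⟨0, hB0⟩ (hA i).isBounded hB.isBounded

lemma haus_lower (hA : ∀ i, IsCompact (A i)) (hA0 : ∀ i, (0:E3) ∈ A i) (hB : IsCompact B) (hB0 : (0:E3) ∈ B)
    (hl : Tendsto (fun i => hausdorffDist (A i) B) atTop (𝓝 0)) {z : E3} (hz : z ∈ B) :
    ∃ w : ℕ → E3, (∀ i, w i ∈ A i) ∧ Tendsto w atTop (𝓝 z) := by
  have : ∀ i : ℕ, ∃ w ∈ A i, dist w z < hausdorffDist (A i) B + 1 / ((i:ℝ) + 1) := fun i =>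
    exists_dist_lt_of_hausdorffDist_lt' hz (lt_add_of_pos_right _ (by positivity)) (haus_ne_top hA hA0 hB hB0 i)
  choose w hw hd using this
  refine ⟨w, hw, ?_⟩
  rw [tendsto_iff_dist_tendsto_zero]
  refine squeeze_zero (fun _ => dist_nonneg) (fun i => (hd i).le) ?_
  simpa using hl.add tendsto_one_div_add_atTop_nhds_zero_nat

lemma haus_upper (hA : ∀ i, IsCompact (A i)) (hA0 : ∀ i, (0:E3) ∈ A i) (hB : IsCompact B) (hB0 : (0:E3) ∈ B)
    (hl : Tendsto (fun i => hausdorffDist (A i) B) atTop (𝓝 0)) {ψ : ℕ → ℕ} (hψ : Tendsto ψ atTop atTop)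
    {w : ℕ → E3} {z : E3} (hw : ∀ i, w i ∈ A (ψ i)) (hz : Tendsto w atTop (𝓝 z)) : z ∈ B := by
  rw [hB.isClosed.mem_iff_infDist_zero ⟨0, hB0⟩]
  have h1 : Tendsto (fun i => infDist (w i) B) atTop (𝓝 0) := 
    squeeze_zero (fun _ => infDist_nonneg)
      (fun i => infDist_le_hausdorffDist_of_mem (hw i) (haus_ne_top hA hA0 hB hB0 (ψ i))) (hl.comp hψ)
  have h2 := ((continuous_infDist_pt B).tendsto z).comp hz
  exact tendsto_nhds_unique h2 h1

lemma eventually_notMem (hA : ∀ i, IsCompact (A i)) (hA0 : ∀ i, (0:E3) ∈ A i) (hB : IsCompact B) (hB0 : (0:E3) ∈ B)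
    (hl : Tendsto (fun i => hausdorffDist (A i) B) atTop (𝓝 0)) {y : E3} (hy : y ∉ B) :
    ∀ᶠ i in atTop, y ∉ A i := by
  have hp : 0 < infDist y B := (hB.isClosed.notMem_iff_infDist_pos ⟨0, hB0⟩).1 hy
  filter_upwards [hl.eventually_lt_const hp] with i hi hyi
  have := infDist_le_hausdorffDist_of_mem hyi (haus_ne_top hA hA0 hB hB0 i)
  linarith

lemma eventually_mem (hA : ∀ i, IsConvexBody (A i)) (hA0 : ∀ i, (0:E3) ∈ A i) (hB : IsCompact B) (hB0 : (0:E3) ∈ B)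
    (hl : Tendsto (fun i => hausdorffDist (A i) B) atTop (𝓝 0)) {y : E3} (hy : y ∈ interior B) :
    ∀ᶠ i in atTop, y ∈ A i := by
  obtain ⟨ε, hε, hb⟩ := Metric.isOpen_iff.1 isOpen_interior y hy
  filter_upwards [hl.eventually_lt_const (half_pos hε)] with i hi
  by_contra hyi
  obtain ⟨ν, hν, hn⟩ := exists_normal (hA i).1 (hA i).2.2 (fun h => hyi (interior_subset h))
  have hm : y + (ε/2) • ν ∈ B := interior_subset (hb (by
    rw [mem_ball, dist_eq_norm, add_sub_cancel_left, norm_smul, hν]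
    rw [Real.norm_of_nonneg (by positivity)]; linarith))
  obtain ⟨w, hw, hd⟩ := exists_dist_lt_of_hausdorffDist_lt' hm hi
    (haus_ne_top (fun i => (hA i).2.1) hA0 hB hB0 i)
  have h1 := hn w hw
  have h2 : (⟪ν, (y + (ε/2) • ν) - w⟫ : ℝ) ≤ ‖ν‖ * ‖(y + (ε/2) • ν) - w‖ := real_inner_le_norm _ _
  rw [hν, one_mul, ← dist_eq_norm, dist_comm] at h2
  have h3 : (⟪ν, (y + (ε/2) • ν) - w⟫ : ℝ) = ε / 2 - ⟪ν, w - y⟫ := by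
    rw [inner_sub_right, inner_add_right, inner_sub_right, real_inner_smul_right, real_inner_self_eq_norm_sq, hν]
    ring
  linarith

lemma rayNormal_limit (hA : ∀ i, IsCompact (A i)) (hA0 : ∀ i, (0:E3) ∈ A i) (hB : IsCompact B) (hB0 : (0:E3) ∈ B)
    (hl : Tendsto (fun i => hausdorffDist (A i) B) atTop (𝓝 0)) {R : ℝ} (hR : ∀ i, ∀ z ∈ A i, ‖z‖ ≤ R)
    {y : E3} (hy0 : y ≠ 0) {ν : E3} (hu : ∀ ν', RayNormal B y ν' → ν' = ν)
    {n : ℕ → E3} (hn : ∀ᶠ i in atTop, RayNormal (A i) y (n i)) : Tendsto n atTop (𝓝 ν) := by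
  have hny : 0 < ‖y‖ := norm_pos_iff.2 hy0
  refine tendsto_of_subseq_tendsto fun ψ hψ => ?_
  obtain ⟨N, hN⟩ := eventually_atTop.1 (hψ.eventually hn)
  have hc : ∀ i, ∃ s : ℝ, 1 ≤ s ∧ s • y ∈ A (ψ (i + N)) ∧ outerNormalAt (A (ψ (i + N))) (s • y) (n (ψ (i + N))) :=
    fun i => hN (i + N) (by omega)
  choose s hs1 hsK hsn using hc
  have hmem : ∀ i, (s i, n (ψ (i + N))) ∈ Icc (1:ℝ) (R / ‖y‖) ×ˢ sphere (0:E3) 1 := by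
    intro i
    refine ⟨⟨hs1 i, ?_⟩, by simpa using (hsn i).1⟩
    have := hR _ _ (hsK i)
    rw [norm_smul, Real.norm_of_nonneg (by linarith [hs1 i])] at this
    rwa [le_div_iff₀ hny]
  obtain ⟨⟨s', ν'⟩, hmem', θ, hθ, hlim⟩ := (isCompact_Icc.prod (isCompact_sphere (0:E3) 1)).tendsto_subseq hmem
  have l1 : Tendsto (fun i => s (θ i)) atTop (𝓝 s') := (continuous_fst.tendsto _).comp hlim
  have l2 : Tendsto (fun i => n (ψ (θ i + N))) atTop (𝓝 ν') := (continuous_snd.tendsto _).comp hlim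
  have hψ' : Tendsto (fun i => ψ (θ i + N)) atTop atTop :=
    hψ.comp ((tendsto_add_atTop_nat N).comp hθ.tendsto_atTop)
  have hray : RayNormal B y ν' := by
    refine ⟨s', hmem'.1.1, ?_, by simpa using hmem'.2, ?_⟩
    · exact haus_upper hA hA0 hB hB0 hl hψ' (fun i => hsK (θ i)) (l1.smul_const y)
    · intro z hz
      obtain ⟨w, hw, hwl⟩ := haus_lower hA hA0 hB hB0 hl hz
      have l3 : Tendsto (fun i => (⟪n (ψ (θ i + N)), w (ψ (θ i + N)) - s (θ i) • y⟫ : ℝ)) atTop (𝓝 ⟪ν', z - s' • y⟫) :=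
        l2.inner ((hwl.comp hψ').sub (l1.smul_const y))
      exact le_of_tendsto' l3 fun i => (hsn (θ i)).2 _ (hw _)
  refine ⟨fun i => θ i + N, ?_⟩
  rw [← hu ν' hray]
  exact l2

lemma tendsto_integral_rayNrm (hA : ∀ i, IsConvexBody (A i)) (hA0 : ∀ i, (0:E3) ∈ A i) (hB : IsConvexBody B)
    (hB0 : (0:E3) ∈ B)
    (hl : Tendsto (fun i => hausdorffDist (A i) B) atTop (𝓝 0)) {R : ℝ} (hR : ∀ i, ∀ z ∈ A i, ‖z‖ ≤ R)
    (φ : BoundedContinuousFunction E3 ℝ) :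
    Tendsto (fun i => ∫ y in A i, φ (rayNrm (A i) y)) atTop (𝓝 (∫ y in B, φ (rayNrm B y))) := by
  have hAm : ∀ i, MeasurableSet (A i) := fun i => (hA i).2.1.isClosed.measurableSet
  have hBm : MeasurableSet B := hB.2.1.isClosed.measurableSet
  simp_rw [← integral_indicator (hAm _), ← integral_indicator hBm]
  refine tendsto_integral_of_dominated_convergence ((closedBall (0:E3) R).indicator fun _ => ‖φ‖) ?_ ?_ ?_ ?_
  · intro i
    rw [aestronglyMeasurable_indicator_iff (hAm i)]
    exact φ.continuous.comp_aestronglyMeasurable (rayNrm_aemeasurable (hA i) (hA0 i)).aestronglyMeasurable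
  · rw [integrable_indicator_iff isClosed_closedBall.measurableSet]
    exact integrableOn_const (isCompact_closedBall _ _).measure_lt_top.ne
  · intro i
    filter_upwards with y
    by_cases hy : y ∈ A i
    · rw [indicator_of_mem hy, indicator_of_mem (by simpa using hR i y hy)]
      exact φ.norm_coe_le_norm _
    · rw [indicator_of_notMem hy, norm_zero]
      exact indicator_nonneg (fun _ _ => norm_nonneg _) _
  · filter_upwards [ae_good hB hB0] with y hy
    by_cases hyB : y ∈ B
    · obtain ⟨hyi, hy0, hs, hu⟩ := hy hyB
      have hev := eventually_mem hA hA0 hB.2.1 hB0 hl hyi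
      rw [indicator_of_mem hyB]
      have hlim := rayNormal_limit (fun i => (hA i).2.1) hA0 hB.2.1 hB0 hl hR hy0 hu
        (n := fun i => rayNrm (A i) y) (hev.mono fun i hi => rayNrm_spec (exists_rayNormal (hA i) hi hy0))
      refine ((φ.continuous.tendsto _).comp hlim).congr' ?_
      filter_upwards [hev] with i hi
      rw [indicator_of_mem hi]; rfl
    · rw [indicator_of_notMem hyB]
      refine tendsto_const_nhds.congr' ?_
      filter_upwards [eventually_notMem (fun i => (hA i).2.1) hA0 hB.2.1 hB0 hl hyB] with i hi
      rw [indicator_of_notMem hi]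

lemma limit_body (hA : ∀ i, IsConvexBody (A i)) (hA0 : ∀ i, (0:E3) ∈ A i) (hB : IsCompact B)
    (hB0 : (0:E3) ∈ B)
    (hl : Tendsto (fun i => hausdorffDist (A i) B) atTop (𝓝 0)) {R : ℝ} (hR : ∀ i, ∀ z ∈ A i, ‖z‖ ≤ R)
    {c : ℝ} (hc : 0 < c) (hv : ∀ i, c ≤ (volume (A i)).toReal) : IsConvexBody B := by
  have hA' := fun i => (hA i).2.1
  have hAm : ∀ i, MeasurableSet (A i) := fun i => (hA i).2.1.isClosed.measurableSet
  have hconv : Convex ℝ B := by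
    intro x hx y hy a b ha hb hab
    obtain ⟨u, hu, hul⟩ := haus_lower hA' hA0 hB hB0 hl hx
    obtain ⟨v, hv, hvl⟩ := haus_lower hA' hA0 hB hB0 hl hy
    exact haus_upper hA' hA0 hB hB0 hl tendsto_id (fun i => (hA i).1 (hu i) (hv i) ha hb hab)
      ((hul.const_smul a).add (hvl.const_smul b))
  refine ⟨hconv, hB, ?_⟩
  by_contra hne
  rw [not_nonempty_iff_eq_empty] at hne
  have hfr := hconv.addHaar_frontier (volume : Measure E3)
  rw [frontier, hne, diff_empty, hB.isClosed.closure_eq] at hfr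
  have hlim : Tendsto (fun i => ∫ y, (A i).indicator (fun _ => (1:ℝ)) y) atTop (𝓝 (∫ y : E3, (0:ℝ))) := by
    refine tendsto_integral_of_dominated_convergence ((closedBall (0:E3) R).indicator fun _ => 1) ?_ ?_ ?_ ?_
    · intro i
      exact aestronglyMeasurable_const.indicator (hAm i)
    · rw [integrable_indicator_iff isClosed_closedBall.measurableSet]
      exact integrableOn_const (isCompact_closedBall _ _).measure_lt_top.ne
    · intro i
      filter_upwards with y
      by_cases hy : y ∈ A i
      · rw [indicator_of_mem hy, indicator_of_mem (by simpa using hR i y hy)]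
        simp
      · rw [indicator_of_notMem hy, norm_zero]
        exact indicator_nonneg (fun _ _ => zero_le_one) _
    · filter_upwards [measure_eq_zero_iff_ae_notMem.1 hfr] with y hy
      refine tendsto_const_nhds.congr' ?_
      filter_upwards [eventually_notMem hA' hA0 hB hB0 hl hy] with i hi
      rw [indicator_of_notMem hi]
  rw [integral_zero] at hlim
  have := ge_of_tendsto' hlim (b := c) fun i => by
    rw [integral_indicator (hAm i)]
    simpa [Measure.real] using hv i
  linarith

end Conv

lemma blaschke {K : ℕ → Set E3} (hK : ∀ i, IsCompact (K i)) (h0 : ∀ i, (0:E3) ∈ K i) {R : ℝ}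
    (hR : ∀ i, ∀ z ∈ K i, ‖z‖ ≤ R) :
    ∃ φ : ℕ → ℕ, StrictMono φ ∧ ∃ B : Set E3, IsCompact B ∧ (0:E3) ∈ B ∧
      Tendsto (fun j => hausdorffDist (K (φ j)) B) atTop (𝓝 0) := by
  let X := closedBall (0:E3) R
  haveI : CompactSpace X := isCompact_iff_compactSpace.1 (isCompact_closedBall _ _)
  have hsub : ∀ i, K i ⊆ X := fun i z hz => by simpa [X] using hR i z hz
  have himg : ∀ i, (Subtype.val '' ((Subtype.val ⁻¹' K i : Set X))) = K i := fun i => by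
    rw [Subtype.image_preimage_coe, inter_eq_right.2 (hsub i)]
  let Q : ℕ → TopologicalSpace.NonemptyCompacts X := fun i =>
    ⟨⟨Subtype.val ⁻¹' K i, ((hK i).isClosed.preimage continuous_subtype_val).isCompact⟩,
      ⟨⟨0, hsub i (h0 i)⟩, h0 i⟩⟩
  obtain ⟨L, φ, hφ, hL⟩ := CompactSpace.tendsto_subseq Q
  refine ⟨φ, hφ, Subtype.val '' (L : Set X), L.isCompact.image continuous_subtype_val, ?_, ?_⟩
  swap
  · rw [tendsto_iff_dist_tendsto_zero] at hL
    refine hL.congr fun j => ?_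
    rw [Function.comp, Metric.NonemptyCompacts.dist_eq]
    conv_rhs => rw [← himg (φ j)]
    rw [hausdorffDist_image isometry_subtype_coe]
    rfl
  · have hcl : IsClosed (Subtype.val '' (L : Set X)) := (L.isCompact.image continuous_subtype_val).isClosed
    rw [hcl.mem_iff_infDist_zero (L.nonempty.image _)]
    have h2 : Tendsto (fun j => hausdorffDist (K (φ j)) (Subtype.val '' (L : Set X))) atTop (𝓝 0) := by
      rw [tendsto_iff_dist_tendsto_zero] at hL
      refine hL.congr fun j => ?_
      rw [Function.comp, Metric.NonemptyCompacts.dist_eq]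
      conv_rhs => rw [← himg (φ j)]
      rw [hausdorffDist_image isometry_subtype_coe]
      rfl
    refine le_antisymm (ge_of_tendsto' h2 fun j => ?_) infDist_nonneg
    exact infDist_le_hausdorffDist_of_mem (h0 _) (hausdorffEDist_ne_top_of_nonempty_of_bounded
      ⟨0, h0 _⟩ (L.nonempty.image _) (hK _).isBounded (L.isCompact.image continuous_subtype_val).isBounded)

theorem stmt15 (lam : ℝ) (hlam : 1 < lam) (K : ℕ → Set E3) (f : ℕ → E3 → ℝ) (C : ℝ)
    (hbody : ∀ i, IsConvexBody (K i)) (h0 : ∀ i, 0 ∈ K i)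
    (hf : ∀ i, ∀ u ∈ unitSphere, 1 / lam < f i u ∧ f i u < lam)
    (hsol : ∀ i, SolvesLMP (K i) (f i))
    (hunif : TendstoUniformlyOn f 1 Filter.atTop unitSphere)
    (hbd : ∀ i, ∀ u ∈ unitSphere, |suppFn (K i) u| ≤ C) :
    ∃ φ : ℕ → ℕ, StrictMono φ ∧
      ∃ K' : Set E3, IsConvexBody K' ∧ 0 ∈ K' ∧
        Filter.Tendsto (fun j => Metric.hausdorffDist (K (φ j)) K') Filter.atTop (nhds 0) ∧
        SolvesLMP K' (fun _ => 1) := by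
  have hS : MeasurableSet unitSphere := isClosed_sphere.measurableSet
  have hlam0 : 0 < lam := by linarith
  have hR : ∀ i, ∀ z ∈ K i, ‖z‖ ≤ max C 0 := by
    intro i z hz
    by_cases hz0 : z = 0
    · simp [hz0]
    have hnz : 0 < ‖z‖ := norm_pos_iff.2 hz0
    refine le_trans ?_ (le_max_left _ _)
    refine le_trans ?_ ((le_abs_self _).trans (hbd i (‖z‖⁻¹ • z) ?_))
    · refine le_csSup ((hbody i).2.1.image (by fun_prop)).bddAbove ⟨z, hz, ?_⟩
      simp only
      rw [real_inner_smul_left, real_inner_self_eq_norm_sq]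
      field_simp
    · simp [unitSphere, norm_smul, hnz.ne']
  have hint : ∀ i, IntegrableOn (f i) unitSphere μH[2] := fun i => lmp_integrable (hbody i) (h0 i) (hsol i)
  have hconst : IntegrableOn (fun _ : E3 => 1 / lam) unitSphere μH[2] := by
    refine (hint 0).mono' aestronglyMeasurable_const ?_
    filter_upwards [ae_restrict_mem hS] with u hu
    rw [Real.norm_of_nonneg (by positivity)]
    exact (hf 0 u hu).1.le
  have hfin : (μH[2] : Measure E3) unitSphere ≠ ⊤ := by
    rw [integrableOn_const_iff] at hconst
    rcases hconst with h | h
    · have : (1 / lam) ≠ 0 := by positivity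
      exact absurd (enorm_eq_zero.1 h) this
    · exact h.ne
  have hvol : ∀ i, 3 * (volume (K i)).toReal = ∫ u in unitSphere, f i u ∂μH[2] := by
    intro i
    rw [← vol_cone_sphere (hbody i) (h0 i)]
    exact hsol i _ subset_rfl hS
  have hpos : (μH[2] : Measure E3) unitSphere ≠ 0 := by
    intro h
    have h1 := hvol 0
    rw [Measure.restrict_eq_zero.2 h, integral_zero_measure] at h1
    have := volume_pos (hbody 0)
    linarith
  have hσ : 0 < ((μH[2] : Measure E3) unitSphere).toReal := ENNReal.toReal_pos hpos hfin
  have hlow : ∀ i, ((μH[2] : Measure E3) unitSphere).toReal * (1 / lam) / 3 ≤ (volume (K i)).toReal := by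
    intro i
    have h1 : ∫ u in unitSphere, (1 / lam) ∂(μH[2] : Measure E3) ≤ ∫ u in unitSphere, f i u ∂μH[2] :=
      setIntegral_mono_on hconst (hint i) hS fun u hu => (hf i u hu).1.le
    rw [setIntegral_const, ← hvol i, smul_eq_mul, Measure.real] at h1
    linarith
  obtain ⟨φ, hφ, B, hB, hB0, hl⟩ := blaschke (fun i => (hbody i).2.1) h0 hR
  have hBb : IsConvexBody B := limit_body (fun i => hbody (φ i)) (fun i => h0 (φ i)) hB hB0 hl
    (fun i => hR (φ i)) (by positivity) (fun i => hlow (φ i))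
  refine ⟨φ, hφ, B, hBb, hB0, hl, lmp_of_integral hBb hB0 hfin fun g => ?_⟩
  have l1 := tendsto_integral_rayNrm (fun i => hbody (φ i)) (fun i => h0 (φ i)) hBb hB0 hl
    (fun i => hR (φ i)) g
  refine tendsto_nhds_unique l1 ?_
  have e : ∀ i, ∫ y in K (φ i), g (rayNrm (K (φ i)) y) = ∫ u in unitSphere, f (φ i) u / 3 * g u ∂μH[2] :=
    fun i => lmp_integral (hbody _) (h0 _) (fun u hu => (lt_trans (by positivity) (hf _ u hu).1).le) (hsol _) g
  simp_rw [e]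
  haveI : IsFiniteMeasure ((μH[2] : Measure E3).restrict unitSphere) :=
    ⟨by rw [Measure.restrict_apply_univ]; exact hfin.lt_top⟩
  refine tendsto_integral_of_dominated_convergence (fun _ => lam / 3 * ‖g‖) ?_ (integrable_const _) ?_ ?_
  · intro i
    exact (Integrable.aestronglyMeasurable (Integrable.div_const (hint (φ i)) 3)).mul g.continuous.aestronglyMeasurable
  · intro i
    filter_upwards [ae_restrict_mem hS] with u hu
    have hp : 0 < f (φ i) u := lt_trans (by positivity) (hf _ u hu).1
    rw [norm_mul, Real.norm_of_nonneg (by positivity)]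
    exact mul_le_mul (by linarith [(hf (φ i) u hu).2]) (g.norm_coe_le_norm u) (norm_nonneg _) (by positivity)
  · filter_upwards [ae_restrict_mem hS] with u hu
    have := (hunif.tendsto_at hu).comp hφ.tendsto_atTop
    exact (this.div_const 3).mul_const _
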